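/- arXiv:1905.09563 — 2 statements merged into one kernel-verified Lean document; each statement's English description precedes it below -/
import Mathlib

section
/- Let X be a reflexive Banach space and φ, ψ₂ : X → ℝ two C¹ functionals, positively homogeneous of degree α > 1, such that φ' + λψ₂' is of class (S)₊ for every λ > 0, and let ψ₁ : X → ℝ be C¹ with ψ₁' completely continuous. Assume φ(u) > 0 for all u ≠ 0 with ψ₁(u) − ψ₂(u) ≥ 0. Then for every b ∈ ℝ the set {u ∈ X : φ(u) ≤ b, ψ₁(u) − ψ₂(u) ≥ 0} is bounded. -/
open Filter Topology

/-- Weak convergence of a sequence in a normed space, tested against all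
continuous linear functionals. -/
def WeakConvSeq {X : Type*} [NormedAddCommGroup X] [NormedSpace ℝ X]
    (u : ℕ → X) (v : X) : Prop :=
  ∀ l : X →L[ℝ] ℝ, Tendsto (fun n => l (u n)) atTop (𝓝 (l v))

/-- A map `F : X → X'` is of class `(S)₊` if whenever `uₙ ⇀ u` weakly and
`limsup ⟨F(uₙ), uₙ − u⟩ ≤ 0`, then `uₙ → u` strongly. -/
def ClassSPlus {X : Type*} [NormedAddCommGroup X] [NormedSpace ℝ X]
    (F : X → X →L[ℝ] ℝ) : Prop :=
  ∀ (u : ℕ → X) (v : X), WeakConvSeq u v →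
    limsup (fun n => F (u n) (u n - v)) atTop ≤ 0 →
    Tendsto u atTop (𝓝 v)

/-- A map is completely continuous if it is continuous and maps bounded
sequences to sequences admitting a (strongly) convergent subsequence. -/
def CompletelyContinuous {X Y : Type*} [NormedAddCommGroup X] [NormedSpace ℝ X]
    [NormedAddCommGroup Y] (F : X → Y) : Prop :=
  Continuous F ∧ ∀ u : ℕ → X, Bornology.IsBounded (Set.range u) →
    ∃ σ : ℕ → ℕ, StrictMono σ ∧ ∃ y : Y, Tendsto (fun k => F (u (σ k))) atTop (𝓝 y)

/-- Any sequence eventually below a null sequence has (real, possibly junk) limsup `≤ 0`. -/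
lemma limsup_le_zero_aux (f g : ℕ → ℝ) (hfg : ∀ᶠ n in atTop, f n ≤ g n)
    (hg : Tendsto g atTop (𝓝 0)) : limsup f atTop ≤ 0 := by
  rw [Filter.limsup_eq]
  by_cases hb : BddBelow {a | ∀ᶠ n in atTop, f n ≤ a}
  · refine le_of_forall_pos_le_add fun ε hε => ?_
    refine csInf_le hb ?_
    filter_upwards [hfg, hg.eventually (gt_mem_nhds hε)] with n h1 h2
    linarith
  · rw [Real.sInf_of_not_bddBelow hb]

/-- Bounded sequences in reflexive spaces have weakly convergent subsequences. -/
lemma exists_weak_subseq {X : Type*} [NormedAddCommGroup X] [NormedSpace ℝ X]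
    (hrefl : Function.Surjective (NormedSpace.inclusionInDoubleDual ℝ X))
    (u : ℕ → X) (R : ℝ) (hu : ∀ n, ‖u n‖ ≤ R) :
    ∃ σ : ℕ → ℕ, StrictMono σ ∧ ∃ v : X, WeakConvSeq (fun n => u (σ n)) v := by
  classical
  let Y : Submodule ℝ X := (Submodule.span ℝ (Set.range u)).topologicalClosure
  have huY : ∀ n, u n ∈ Y := fun n =>
    Submodule.le_topologicalClosure _ (Submodule.subset_span ⟨n, rfl⟩)
  have hYc : IsClosed (Y : Set X) := Submodule.isClosed_topologicalClosure _
  have hYs : TopologicalSpace.IsSeparable (Y : Set X) := by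
    have h1 : TopologicalSpace.IsSeparable (Set.range u) :=
      (Set.countable_range u).isSeparable
    have h2 := h1.span (R := ℝ)
    exact h2.closure
  obtain ⟨c, hc, hYsub⟩ := hYs
  have : Countable c := hc.to_subtype
  choose g hg1 hg2 using fun d : X => exists_dual_vector'' ℝ d
  have hsep : ∀ y ∈ Y, (∀ d : c, g d y = 0) → y = 0 := by
    intro y hy h0
    by_contra hne
    have hpos : 0 < ‖y‖ := norm_pos_iff.mpr hne
    obtain ⟨d, hd, hdist⟩ := Metric.mem_closure_iff.mp (hYsub hy) (‖y‖ / 2) (by positivity)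
    have h3 : ‖d‖ ≤ ‖d - y‖ := by
      have : g d (d - y) = ‖d‖ := by
        rw [map_sub, h0 ⟨d, hd⟩, hg2]; simp
      rw [← this]
      calc g d (d - y) ≤ ‖g d (d - y)‖ := Real.le_norm_self _
        _ ≤ ‖g d‖ * ‖d - y‖ := (g d).le_opNorm _
        _ ≤ 1 * ‖d - y‖ := by gcongr; exact hg1 d
        _ = _ := one_mul _
    rw [dist_eq_norm, norm_sub_rev] at hdist
    have h4 : ‖y‖ ≤ ‖d‖ + ‖d - y‖ := by
      have := norm_sub_le d (d - y)
      simpa using this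
    linarith
  have hcpt : IsCompact (Set.univ.pi fun _ : c => Set.Icc (-R) R) :=
    isCompact_univ_pi fun _ => isCompact_Icc
  have hmem : ∀ n, (fun d : c => g d (u n)) ∈ (Set.univ.pi fun _ : c => Set.Icc (-R) R) := by
    intro n d _
    change g d (u n) ∈ Set.Icc (-R) R
    rw [Set.mem_Icc, ← abs_le]
    have := (g d).le_opNorm (u n)
    rw [Real.norm_eq_abs] at this
    have h5 := mul_le_mul_of_nonneg_right (hg1 d) (norm_nonneg (u n))
    linarith [hu n]
  obtain ⟨a, -, σ, hσ, hlim⟩ := hcpt.tendsto_subseq hmem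
  refine ⟨σ, hσ, ?_⟩
  rw [tendsto_pi_nhds] at hlim
  let K : Set (WeakDual ℝ (StrongDual ℝ X)) :=
    WeakDual.toStrongDual ⁻¹' Metric.closedBall 0 R
  have hK : IsCompact K := WeakDual.isCompact_closedBall 0 R
  let J : X → WeakDual ℝ (StrongDual ℝ X) := fun x =>
    StrongDual.toWeakDual (NormedSpace.inclusionInDoubleDual ℝ X x)
  have hJ : ∀ x l, J x l = l x := fun x l => rfl
  have hJK : ∀ n, J (u (σ n)) ∈ K := by
    intro n
    have h : NormedSpace.inclusionInDoubleDual ℝ X (u (σ n)) ∈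
        Metric.closedBall (0 : StrongDual ℝ (StrongDual ℝ X)) R := by
      refine (mem_closedBall_zero_iff (E := StrongDual ℝ (StrongDual ℝ X))).mpr ?_
      exact (NormedSpace.double_dual_bound ℝ X _).trans (hu _)
    exact h
  have hJs : ∀ f, ∃ x, J x = f := by
    intro f
    obtain ⟨x, hx⟩ := hrefl (WeakDual.toStrongDual f)
    exact ⟨x, by simp only [J, hx]; rfl⟩
  have hev : ∀ l : StrongDual ℝ X, Continuous fun f : WeakDual ℝ (StrongDual ℝ X) => f l :=
    fun l => WeakDual.eval_continuous l
  have hclY : ∀ w, MapClusterPt (J w) atTop (fun n => J (u (σ n))) →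
      w ∈ Y ∧ ∀ d : c, g d w = a d := by
    intro w hw
    have hcl : ∀ l : StrongDual ℝ X, MapClusterPt (l w) atTop (fun n => l (u (σ n))) := by
      intro l
      exact hw.tendsto_comp (f := fun f : WeakDual ℝ (StrongDual ℝ X) => f l)
        ((hev l).tendsto (J w))
    constructor
    · by_contra hwY
      obtain ⟨l, r, h1, h2⟩ := geometric_hahn_banach_closed_point Y.convex hYc hwY
      have := (hcl l).frequently (lt_mem_nhds h2)
      obtain ⟨n, hn⟩ := this.exists
      exact absurd (h1 _ (huY (σ n))) (not_lt.mpr hn.le)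
    · intro d
      by_contra hne
      have h1 := hlim d
      obtain ⟨U, V, hU, hV, hUV⟩ := t2_separation_nhds hne
      obtain ⟨n, hn1, hn2⟩ := ((hcl (g d)).frequently hU).and_eventually
        (h1.eventually hV) |>.exists
      exact Set.disjoint_left.mp hUV hn1 hn2
  obtain ⟨f, hfK, hf⟩ := hK.exists_mapClusterPt (f := atTop)
    (u := fun n => J (u (σ n))) (Filter.tendsto_principal.mpr (Eventually.of_forall hJK))
  obtain ⟨v, rfl⟩ := hJs f
  refine ⟨v, ?_⟩
  have hT : Tendsto (fun n => J (u (σ n))) atTop (𝓝 (J v)) := by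
    refine hK.tendsto_nhds_of_unique_mapClusterPt (Eventually.of_forall hJK) ?_
    intro f' _ hf'
    obtain ⟨w, rfl⟩ := hJs f'
    obtain ⟨h1, h2⟩ := hclY w hf'
    obtain ⟨h3, h4⟩ := hclY v hf
    have : w - v = 0 := hsep _ (Y.sub_mem h1 h3) fun d => by
      rw [map_sub, h2, h4, sub_self]
    rw [sub_eq_zero.mp this]
  intro l
  exact ((hev l).tendsto _).comp hT

/-- Strong-weak convergence of the duality pairing. -/
lemma pairing_tendsto {X : Type*} [NormedAddCommGroup X] [NormedSpace ℝ X]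
    (F : ℕ → X →L[ℝ] ℝ) (F0 : X →L[ℝ] ℝ) (hF : Tendsto F atTop (𝓝 F0))
    (u : ℕ → X) (v : X) (hw : WeakConvSeq u v) (R : ℝ) (hR : ∀ n, ‖u n - v‖ ≤ R) :
    Tendsto (fun n => F n (u n - v)) atTop (𝓝 0) := by
  have h1 : Tendsto (fun n => (F n - F0) (u n - v)) atTop (𝓝 0) := by
    have h2 : Tendsto (fun n => ‖F n - F0‖ * R) atTop (𝓝 0) := by
      have := (tendsto_iff_norm_sub_tendsto_zero.mp hF).mul_const R
      simpa using this
    refine squeeze_zero_norm (fun n => ?_) h2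
    exact ((F n - F0).le_opNorm _).trans (by gcongr; exact hR n)
  have h3 : Tendsto (fun n => F0 (u n - v)) atTop (𝓝 0) := by
    have := (hw F0).sub_const (F0 v)
    simpa using this
  have := h1.add h3
  simpa using this

/-- Mean value theorem along the segment from `v + s(u-v)` to `u`. -/
lemma mvt_segment {X : Type*} [NormedAddCommGroup X] [NormedSpace ℝ X]
    (Φ : X → ℝ) (hΦ : ContDiff ℝ 1 Φ) (u v : X) (s : ℝ) (hs : s < 1) :
    ∃ t ∈ Set.Ioo s 1, (1 - s) * fderiv ℝ Φ (v + t • (u - v)) (u - v)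
      = Φ u - Φ (v + s • (u - v)) := by
  have hd : ∀ t : ℝ, HasDerivAt (fun t : ℝ => Φ (v + t • (u - v)))
      (fderiv ℝ Φ (v + t • (u - v)) (u - v)) t := by
    intro t
    have h1 : HasDerivAt (fun t : ℝ => v + t • (u - v)) (u - v) t := by
      simpa using ((hasDerivAt_id t).smul_const (u - v)).const_add v
    exact ((hΦ.differentiable one_ne_zero) _).hasFDerivAt.comp_hasDerivAt t h1
  obtain ⟨t, ht, h⟩ := exists_hasDerivAt_eq_slope _ _ hs
    (fun x _ => (hd x).continuousAt.continuousWithinAt) (fun x _ => hd x)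
  refine ⟨t, ht, ?_⟩
  have hne : (1 - s) ≠ 0 := by linarith
  rw [h]
  field_simp
  simp

lemma weakConv_segment {X : Type*} [NormedAddCommGroup X] [NormedSpace ℝ X]
    (u : ℕ → X) (v : X) (hw : WeakConvSeq u v) (t : ℕ → ℝ) (ht : ∀ n, |t n| ≤ 1) :
    WeakConvSeq (fun n => v + t n • (u n - v)) v := by
  intro l
  have h1 : Tendsto (fun n => l (u n) - l v) atTop (𝓝 0) := by
    have := (hw l).sub_const (l v)
    simpa using this
  have h2 : Tendsto (fun n => t n * (l (u n) - l v)) atTop (𝓝 0) := by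
    refine squeeze_zero_norm (fun n => ?_) (by simpa using h1.norm)
    rw [norm_mul]
    exact mul_le_of_le_one_left (norm_nonneg _) (ht n)
  have := h2.const_add (l v)
  simpa using this

/-- Weak sequential lower semicontinuity from class `(S)₊`. -/
lemma lsc_of_splus {X : Type*} [NormedAddCommGroup X] [NormedSpace ℝ X]
    (Φ : X → ℝ) (hΦ : ContDiff ℝ 1 Φ) (hS : ClassSPlus (fderiv ℝ Φ))
    (u : ℕ → X) (v : X) (hw : WeakConvSeq u v) (R : ℝ) (hR : ∀ n, ‖u n - v‖ ≤ R)
    (e : ℕ → ℝ) (L : ℝ) (he : Tendsto e atTop (𝓝 L)) (hle : ∀ n, Φ (u n) ≤ e n) :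
    Φ v ≤ L := by
  by_contra! hlt
  choose t ht hmv using fun n => mvt_segment Φ hΦ (u n) v 0 one_pos
  simp only [sub_zero, one_mul, zero_smul, add_zero] at hmv
  have hww := weakConv_segment u v hw t fun n => by
    rw [abs_le]; constructor <;> linarith [(ht n).1, (ht n).2]
  have hst := hS _ v hww (limsup_le_zero_aux _ (fun _ => 0) (by
    filter_upwards [he.eventually (gt_mem_nhds hlt)] with n hn
    rw [add_sub_cancel_left, map_smul, hmv, smul_eq_mul]
    have := hle n
    exact mul_nonpos_of_nonneg_of_nonpos (ht n).1.le (by linarith)) tendsto_const_nhds)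
  have hF := ((hΦ.continuous_fderiv one_ne_zero).tendsto v).comp hst
  have hp := pairing_tendsto _ _ hF u v hw R hR
  simp only [Function.comp_apply, hmv] at hp
  have := le_of_tendsto_of_tendsto' hp (he.sub_const (Φ v)) fun n => by linarith [hle n]
  linarith

/-- Euler's identity for positively homogeneous functions. -/
lemma euler_hom {X : Type*} [NormedAddCommGroup X] [NormedSpace ℝ X]
    (Φ : X → ℝ) (hΦ : ContDiff ℝ 1 Φ) (α : ℝ)
    (hh : ∀ t : ℝ, 0 < t → ∀ u, Φ (t • u) = t ^ α * Φ u) (u : X) :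
    fderiv ℝ Φ u u = α * Φ u := by
  have h1 : HasDerivAt (fun t : ℝ => t • u) u 1 := by
    simpa using (hasDerivAt_id (1 : ℝ)).smul_const u
  have h2 : HasFDerivAt Φ (fderiv ℝ Φ u) ((1 : ℝ) • u) := by
    rw [one_smul]
    exact ((hΦ.differentiable one_ne_zero) _).hasFDerivAt
  have h3 : HasDerivAt (fun t : ℝ => Φ (t • u)) (fderiv ℝ Φ u u) 1 :=
    h2.comp_hasDerivAt 1 h1
  have h4 : HasDerivAt (fun t : ℝ => t ^ α * Φ u) (α * Φ u) 1 := by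
    have := (Real.hasDerivAt_rpow_const (x := 1) (p := α) (Or.inl one_ne_zero)).mul_const (Φ u)
    simpa using this
  have h5 : (fun t : ℝ => Φ (t • u)) =ᶠ[𝓝 1] fun t : ℝ => t ^ α * Φ u := by
    filter_upwards [lt_mem_nhds (zero_lt_one (α := ℝ))] with t ht using hh t ht u
  exact h3.unique (h4.congr_of_eventuallyEq h5)

theorem stmt2 {X : Type*} [NormedAddCommGroup X] [NormedSpace ℝ X] [CompleteSpace X]
    (hrefl : Function.Surjective (NormedSpace.inclusionInDoubleDual ℝ X))
    (φ ψ₁ ψ₂ : X → ℝ) (α : ℝ) (hα : 1 < α)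
    (hφC : ContDiff ℝ 1 φ) (hψ₁C : ContDiff ℝ 1 ψ₁) (hψ₂C : ContDiff ℝ 1 ψ₂)
    (hφe : ∀ u, φ (-u) = φ u) (hψ₁e : ∀ u, ψ₁ (-u) = ψ₁ u) (hψ₂e : ∀ u, ψ₂ (-u) = ψ₂ u)
    (hφh : ∀ t : ℝ, 0 < t → ∀ u, φ (t • u) = t ^ α * φ u)
    (hψ₁h : ∀ t : ℝ, 0 < t → ∀ u, ψ₁ (t • u) = t ^ α * ψ₁ u)
    (hψ₂h : ∀ t : ℝ, 0 < t → ∀ u, ψ₂ (t • u) = t ^ α * ψ₂ u)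
    (hS : ∀ lam : ℝ, 0 < lam →
      ClassSPlus (fun u => fderiv ℝ φ u + lam • fderiv ℝ ψ₂ u))
    (hcc : CompletelyContinuous (fun u => fderiv ℝ ψ₁ u))
    (hpos : ∀ u : X, u ≠ 0 → 0 ≤ ψ₁ u - ψ₂ u → 0 < φ u) :
    ∀ b : ℝ, Bornology.IsBounded {u : X | φ u ≤ b ∧ 0 ≤ ψ₁ u - ψ₂ u} := by
  intro b
  by_contra hunb
  have hex : ∀ n : ℕ, ∃ u : X, (φ u ≤ b ∧ 0 ≤ ψ₁ u - ψ₂ u) ∧ (n : ℝ) + 1 < ‖u‖ := by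
    intro n
    by_contra! hcon
    exact hunb (isBounded_iff_forall_norm_le.mpr ⟨n + 1, fun u hu => hcon u hu⟩)
  choose u hu hun using hex
  let z : ℕ → X := fun n => ‖u n‖⁻¹ • u n
  have hup : ∀ n, 0 < ‖u n‖ := fun n => by
    have := hun n
    have : (0 : ℝ) ≤ n := n.cast_nonneg
    linarith
  have hz1 : ∀ n, ‖z n‖ = 1 := fun n => by
    simp only [z, norm_smul, norm_inv, norm_norm]
    exact inv_mul_cancel₀ (hup n).ne'
  have hzφ : ∀ n : ℕ, φ (z n) ≤ |b| * (1 / ((n : ℝ) + 1)) := fun n => by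
    have h0 : (0 : ℝ) ≤ n := n.cast_nonneg
    simp only [z]
    rw [hφh _ (inv_pos.mpr (hup n))]
    have h1 : ‖u n‖⁻¹ ≤ 1 / ((n : ℝ) + 1) := by
      rw [one_div]
      exact inv_anti₀ (by positivity) (hun n).le
    have h1' : ‖u n‖⁻¹ ≤ 1 := inv_le_one_of_one_le₀ (by linarith [hun n])
    have h2 : (‖u n‖⁻¹) ^ α ≤ ‖u n‖⁻¹ := by
      have := Real.rpow_le_rpow_of_exponent_ge (inv_pos.mpr (hup n)) h1' hα.le
      rwa [Real.rpow_one] at this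
    have h3 : 0 ≤ (‖u n‖⁻¹) ^ α := by positivity
    calc (‖u n‖⁻¹) ^ α * φ (u n) ≤ (‖u n‖⁻¹) ^ α * |b| := by
          gcongr
          exact (hu n).1.trans (le_abs_self b)
      _ ≤ (1 / ((n : ℝ) + 1)) * |b| := by
          gcongr
          exact h2.trans h1
      _ = _ := mul_comm _ _
  have hzψ : ∀ n, ψ₂ (z n) ≤ ψ₁ (z n) := fun n => by
    simp only [z]
    rw [hψ₁h _ (inv_pos.mpr (hup n)), hψ₂h _ (inv_pos.mpr (hup n))]
    have := (hu n).2
    gcongr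
    linarith
  obtain ⟨σ, hσ, v, hv⟩ := exists_weak_subseq hrefl z 1 fun n => (hz1 n).le
  have hR : ∀ n, ‖z n - v‖ ≤ 1 + ‖v‖ := fun n => by
    have := norm_sub_le (z n) v
    rwa [hz1] at this
  choose t ht hmv using fun n => mvt_segment ψ₁ hψ₁C (z (σ n)) v 0 one_pos
  simp only [sub_zero, one_mul, zero_smul, add_zero] at hmv
  obtain ⟨τ, hτ, y, hy⟩ := hcc.2 (fun n => v + t n • (z (σ n) - v)) (by
    refine isBounded_iff_forall_norm_le.mpr ⟨‖v‖ + 1 * (1 + ‖v‖), ?_⟩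
    rintro _ ⟨n, rfl⟩
    refine (norm_add_le _ _).trans ?_
    rw [norm_smul]
    gcongr
    · rw [Real.norm_eq_abs, abs_le]
      constructor <;> linarith [(ht n).1, (ht n).2]
    · exact hR _)
  let w : ℕ → X := fun n => z (σ (τ n))
  have hw : WeakConvSeq w v := fun l => (hv l).comp hτ.tendsto_atTop
  have hRw : ∀ n, ‖w n - v‖ ≤ 1 + ‖v‖ := fun n => hR _
  have hψlim : Tendsto (fun n => ψ₁ (w n)) atTop (𝓝 (ψ₁ v)) := by
    have h1 := pairing_tendsto _ y hy w v hw _ hRw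
    simp only [w, hmv] at h1
    have := h1.add_const (ψ₁ v)
    simpa using this
  let c : ℕ → ℝ := fun n => |b| * (1 / (((σ (τ n) : ℕ) : ℝ) + 1))
  have hc : Tendsto c atTop (𝓝 0) := by
    have h1 := (tendsto_one_div_add_atTop_nhds_zero_nat (𝕜 := ℝ)).const_mul |b|
    rw [mul_zero] at h1
    exact h1.comp (hσ.comp hτ).tendsto_atTop
  have hcφ : ∀ n, φ (w n) ≤ c n := fun n => hzφ _
  have hwψ : ∀ n, ψ₂ (w n) ≤ ψ₁ (w n) := fun n => hzψ _
  have hΦC : ∀ lam : ℝ, ContDiff ℝ 1 (fun x => φ x + lam * ψ₂ x) := fun lam =>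
    hφC.add (contDiff_const.mul hψ₂C)
  have hΦd : ∀ lam : ℝ, fderiv ℝ (fun x => φ x + lam * ψ₂ x)
      = fun x => fderiv ℝ φ x + lam • fderiv ℝ ψ₂ x := fun lam => by
    ext1 x
    have h1 := ((hφC.differentiable one_ne_zero) x).hasFDerivAt
    have h2 := ((hψ₂C.differentiable one_ne_zero) x).hasFDerivAt
    exact (h1.add (h2.const_mul lam)).fderiv
  have hΦS : ∀ lam : ℝ, 0 < lam → ClassSPlus (fderiv ℝ (fun x => φ x + lam * ψ₂ x)) :=
    fun lam hl => by rw [hΦd]; exact hS lam hl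
  have hbd : ∀ lam : ℝ, 0 < lam → ∀ n, φ (w n) + lam * ψ₂ (w n) ≤ c n + lam * ψ₁ (w n) :=
    fun lam hl n => add_le_add (hcφ n) (mul_le_mul_of_nonneg_left (hwψ n) hl.le)
  have hel : ∀ lam : ℝ, Tendsto (fun n => c n + lam * ψ₁ (w n)) atTop (𝓝 (lam * ψ₁ v)) :=
    fun lam => by simpa using hc.add (hψlim.const_mul lam)
  have hkey : ∀ lam : ℝ, 0 < lam → φ v ≤ lam * (ψ₁ v - ψ₂ v) := fun lam hl => by
    have := lsc_of_splus _ (hΦC lam) (hΦS lam hl) w v hw _ hRw _ _ (hel lam) (hbd lam hl)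
    linarith
  have hv0 : v = 0 := by
    by_contra hne
    have hD : 0 ≤ ψ₁ v - ψ₂ v := by
      by_contra! hneg
      have h1 := hkey ((|φ v| + 1) / -(ψ₁ v - ψ₂ v)) (div_pos (by positivity) (by linarith))
      have h2 : (|φ v| + 1) / -(ψ₁ v - ψ₂ v) * (ψ₁ v - ψ₂ v) = -(|φ v| + 1) := by
        field_simp [hneg.ne]
      rw [h2] at h1
      linarith [neg_abs_le (φ v)]
    have hp := hpos v hne hD
    have h1 := hkey (φ v / (2 * (ψ₁ v - ψ₂ v + 1))) (by positivity)
    rw [div_mul_eq_mul_div, le_div_iff₀ (by positivity)] at h1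
    nlinarith
  subst hv0
  have hψ0 : ψ₁ 0 = 0 := by
    have h1 := euler_hom ψ₁ hψ₁C α hψ₁h 0
    rw [map_zero] at h1
    rcases mul_eq_zero.mp h1.symm with h | h
    · linarith
    · exact h
  have hst := hΦS 1 one_pos w 0 hw (limsup_le_zero_aux _
    (fun n => α * (c n + 1 * ψ₁ (w n))) (Eventually.of_forall fun n => by
      rw [sub_zero, euler_hom _ (hΦC 1) α (fun s hs x => by
        rw [hφh s hs, hψ₂h s hs]; ring)]
      exact mul_le_mul_of_nonneg_left (hbd 1 one_pos n) (by linarith)) (by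
      simpa [hψ0] using (hel 1).const_mul α))
  have hn := hst.norm
  have hw1 : ∀ n, ‖w n‖ = 1 := fun n => hz1 _
  simp only [hw1, norm_zero] at hn
  exact one_ne_zero (tendsto_nhds_unique tendsto_const_nhds hn)
end

section
/- Under the same hypotheses as the boundedness lemma (φ, ψ₁, ψ₂ even C¹ functionals on a reflexive Banach space X, positively homogeneous of degree α > 1, φ' + λψ₂' of class (S)₊ for all λ > 0, ψ₁' completely continuous, φ(u) > 0 whenever u ≠ 0 and ψ₁(u) − ψ₂(u) ≥ 0), if the manifold M̂ = {u ∈ X : ψ₁(u) − ψ₂(u) = 1} is nonempty, then inf_{u ∈ M̂} φ(u) > 0. -/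
open Filter Topology

lemma limsup_le_zero_aux_s3 (x : ℕ → ℝ) (h : ∀ ε > 0, ∀ᶠ n in atTop, x n ≤ ε) :
    limsup x atTop ≤ 0 := by
  rw [Filter.limsup_eq]
  by_cases hb : BddBelow {a | ∀ᶠ n in atTop, x n ≤ a}
  · refine le_of_forall_pos_le_add fun ε hε => ?_
    rw [zero_add]
    exact csInf_le hb (h ε hε)
  · rw [Real.sInf_of_not_bddBelow hb]

lemma mvt_aux {X : Type*} [NormedAddCommGroup X] [NormedSpace ℝ X]
    {f : X → ℝ} {F : X → X →L[ℝ] ℝ} (hf : ∀ u, HasFDerivAt f (F u) u) (v u : X) :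
    ∃ t : ℝ, 0 ≤ t ∧ t ≤ 1 ∧ f u - f v = F (v + t • (u - v)) (u - v) := by
  obtain ⟨z, hz, h⟩ := domain_mvt (f := f) (s := Set.univ) (x := v) (y := u) (f' := F)
    (fun x _ => (hf x).hasFDerivWithinAt) convex_univ (Set.mem_univ _) (Set.mem_univ _)
  rw [segment_eq_image'] at hz
  obtain ⟨t, ht, rfl⟩ := hz
  exact ⟨t, ht.1, ht.2, h⟩

lemma euler_aux {X : Type*} [NormedAddCommGroup X] [NormedSpace ℝ X]
    {f : X → ℝ} {F : X → X →L[ℝ] ℝ} (hf : ∀ u, HasFDerivAt f (F u) u) (α : ℝ)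
    (hh : ∀ t : ℝ, 0 < t → ∀ u, f (t • u) = t ^ α * f u) (u : X) :
    F u u = α * f u := by
  have h1 : HasDerivAt (fun t : ℝ => f (t • u)) (F u u) 1 := by
    have h2 : HasDerivAt (fun t : ℝ => t • u) u 1 := by
      simpa using (hasDerivAt_id (1 : ℝ)).smul_const u
    have h3 : HasFDerivAt f (F u) ((1 : ℝ) • u) := by simpa using hf u
    exact h3.comp_hasDerivAt 1 h2
  have h4 : HasDerivAt (fun t : ℝ => t ^ α * f u) (α * f u) 1 := by
    have := (Real.hasDerivAt_rpow_const (x := 1) (p := α) (Or.inl one_ne_zero)).mul_const (f u)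
    simpa using this
  have h5 : (fun t : ℝ => f (t • u)) =ᶠ[𝓝 1] fun t : ℝ => t ^ α * f u := by
    filter_upwards [lt_mem_nhds (zero_lt_one (α := ℝ))] with t ht
    exact hh t ht u
  exact (h1.congr_of_eventuallyEq h5.symm).unique h4

lemma apply_tendsto_zero_aux {X : Type*} [NormedAddCommGroup X] [NormedSpace ℝ X]
    {G : ℕ → X →L[ℝ] ℝ} {y : X →L[ℝ] ℝ} (hG : Tendsto G atTop (𝓝 y))
    {u : ℕ → X} {v : X} (hu : WeakConvSeq u v) (C : ℝ) (hC : ∀ n, ‖u n - v‖ ≤ C) :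
    Tendsto (fun n => G n (u n - v)) atTop (𝓝 0) := by
  have h1 : Tendsto (fun n => (G n - y) (u n - v)) atTop (𝓝 0) := by
    have h2 : Tendsto (fun n => ‖G n - y‖ * C) atTop (𝓝 0) := by
      have := (tendsto_iff_norm_sub_tendsto_zero.1 hG).mul_const C
      simpa using this
    refine squeeze_zero_norm (fun n => ?_) h2
    exact ((G n - y).le_opNorm _).trans (by gcongr; exact hC n)
  have h3 : Tendsto (fun n => y (u n - v)) atTop (𝓝 0) := by
    have := (hu y).sub_const (y v)
    simpa using this
  have := h1.add h3
  simpa using this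

lemma weak_segment_aux {X : Type*} [NormedAddCommGroup X] [NormedSpace ℝ X]
    {u : ℕ → X} {v : X} (hu : WeakConvSeq u v) {t : ℕ → ℝ} (h0 : ∀ n, 0 ≤ t n)
    (h1 : ∀ n, t n ≤ 1) : WeakConvSeq (fun n => v + t n • (u n - v)) v := by
  intro l
  have h3 : Tendsto (fun n => |l (u n) - l v|) atTop (𝓝 0) := by
    have := ((hu l).sub_const (l v)).abs
    simpa using this
  have h4 : Tendsto (fun n => t n * (l (u n) - l v)) atTop (𝓝 0) := by
    refine squeeze_zero_norm (fun n => ?_) h3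
    rw [norm_mul, Real.norm_eq_abs, Real.norm_eq_abs, abs_of_nonneg (h0 n)]
    exact mul_le_of_le_one_left (abs_nonneg _) (h1 n)
  have := h4.const_add (l v)
  simpa using this

lemma wlsc_aux {X : Type*} [NormedAddCommGroup X] [NormedSpace ℝ X]
    {f : X → ℝ} {F : X → X →L[ℝ] ℝ} (hf : ∀ u, HasFDerivAt f (F u) u)
    (hFc : Continuous F) (hS : ClassSPlus F)
    {u : ℕ → X} {v : X} (hu : WeakConvSeq u v) (C : ℝ) (hC : ∀ n, ‖u n - v‖ ≤ C) :
    ∀ ε > 0, ∀ᶠ n in atTop, f v - ε ≤ f (u n) := by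
  intro ε hε
  by_contra hcon
  have hfr : ∃ᶠ n in atTop, f (u n) < f v - ε := by
    rw [Filter.not_eventually] at hcon
    exact hcon.mono fun n hn => not_le.1 hn
  obtain ⟨σ, hσ, hlt⟩ := extraction_of_frequently_atTop hfr
  have huσ : WeakConvSeq (fun n => u (σ n)) v := fun l => (hu l).comp hσ.tendsto_atTop
  choose t h0 h1 hmv using fun n => mvt_aux hf v (u (σ n))
  have hw := weak_segment_aux huσ h0 h1
  have hlim := hS _ v hw (limsup_le_zero_aux_s3 _ fun e he => Eventually.of_forall fun n => by
    have : F (v + t n • (u (σ n) - v)) (v + t n • (u (σ n) - v) - v)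
        = t n * (f (u (σ n)) - f v) := by
      rw [add_sub_cancel_left, map_smul, hmv n, smul_eq_mul]
    rw [this]
    nlinarith [h0 n, hlt n, mul_nonneg (h0 n) (by linarith [hlt n] : 0 ≤ f v - f (u (σ n)))])
  have hG := (hFc.tendsto v).comp hlim
  have h2 := apply_tendsto_zero_aux hG huσ C (fun n => hC _)
  have h3 : ∀ᶠ n in atTop, -ε < (F ∘ fun n => v + t n • (u (σ n) - v)) n (u (σ n) - v) :=
    h2.eventually (lt_mem_nhds (by linarith))
  obtain ⟨n, hn⟩ := h3.exists
  simp only [Function.comp] at hn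
  rw [← hmv n] at hn
  linarith [hlt n]

lemma wcont_aux {X : Type*} [NormedAddCommGroup X] [NormedSpace ℝ X]
    {f : X → ℝ} {F : X → X →L[ℝ] ℝ} (hf : ∀ u, HasFDerivAt f (F u) u)
    (hcc : CompletelyContinuous F)
    {u : ℕ → X} {v : X} (hu : WeakConvSeq u v) (C : ℝ) (hC : ∀ n, ‖u n - v‖ ≤ C) :
    ∃ σ : ℕ → ℕ, StrictMono σ ∧ Tendsto (fun n => f (u (σ n))) atTop (𝓝 (f v)) := by
  choose t h0 h1 hmv using fun n => mvt_aux hf v (u n)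
  obtain ⟨σ, hσ, y, hy⟩ := hcc.2 (fun n => v + t n • (u n - v)) (by
    rw [isBounded_iff_forall_norm_le]
    refine ⟨‖v‖ + C, ?_⟩
    rintro _ ⟨n, rfl⟩
    refine (norm_add_le _ _).trans ?_
    rw [norm_smul, Real.norm_eq_abs, abs_of_nonneg (h0 n)]
    have := mul_le_of_le_one_left (norm_nonneg (u n - v)) (h1 n)
    linarith [hC n])
  refine ⟨σ, hσ, ?_⟩
  have huσ : WeakConvSeq (fun n => u (σ n)) v := fun l => (hu l).comp hσ.tendsto_atTop
  have h2 := (apply_tendsto_zero_aux hy huσ C (fun n => hC _)).const_add (f v)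
  rw [add_zero] at h2
  refine h2.congr fun n => ?_
  rw [← hmv]; ring

lemma weak_seq_compact_aux {X : Type*} [NormedAddCommGroup X] [NormedSpace ℝ X]
    (hrefl : Function.Surjective (NormedSpace.inclusionInDoubleDual ℝ X))
    (u : ℕ → X) (hb : Bornology.IsBounded (Set.range u)) :
    ∃ (v : X) (σ : ℕ → ℕ), StrictMono σ ∧ WeakConvSeq (fun n => u (σ n)) v := by
  set S : Set (WeakSpace ℝ X) := toWeakSpace ℝ X '' (Set.range u) with hSdef
  have hK : IsCompact (closure S) := by
    apply NormedSpace.isCompact_closure_of_isBounded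
    · rw [hSdef, Set.preimage_image_eq _ (toWeakSpace ℝ X).injective]
      exact hb
    · intro z _
      obtain ⟨x, hx⟩ := hrefl (WeakDual.toStrongDual z)
      refine ⟨toWeakSpace ℝ X x, ?_⟩
      refine DFunLike.ext _ _ fun l => ?_
      exact congrArg (fun g => g l) hx
  set Y : Submodule ℝ X := (Submodule.span ℝ (Set.range u)).topologicalClosure with hY
  have hKY : closure S ⊆ toWeakSpace ℝ X '' (Y : Set X) := by
    have h1 := (Submodule.span ℝ (Set.range u)).convex.toWeakSpace_closure ℝ
    rw [hY, Submodule.topologicalClosure_coe, h1]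
    exact closure_mono (Set.image_mono Submodule.subset_span)
  have hsep : TopologicalSpace.IsSeparable (Y : Set X) := by
    rw [hY, Submodule.topologicalClosure_coe]
    exact (Set.countable_range u).isSeparable.span.closure
  obtain ⟨D, hDc, hD⟩ := hsep
  have hDne : D.Nonempty := by
    rw [← closure_nonempty_iff]; exact ⟨0, hD Y.zero_mem⟩
  obtain ⟨c, rfl⟩ := hDc.exists_eq_range hDne
  choose l hl1 hl2 using fun k => exists_dual_vector'' ℝ (c k)
  have hev : ∀ g : X →L[ℝ] ℝ, Continuous (fun k : WeakSpace ℝ X => g ((toWeakSpace ℝ X).symm k)) :=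
    fun g => WeakBilin.eval_continuous (topDualPairing ℝ X).flip g
  have hcs : CompactSpace (closure S) := isCompact_iff_compactSpace.1 hK
  have hmet : TopologicalSpace.MetrizableSpace (closure S) := by
    refine Metric.PiNatEmbed.TopologicalSpace.MetrizableSpace.of_countable_separating
      (fun n (k : closure S) => l n ((toWeakSpace ℝ X).symm k.1))
      (fun n => (hev (l n)).comp continuous_subtype_val) ?_
    intro x y hxy
    obtain ⟨a, ha, hax⟩ := hKY x.2
    obtain ⟨b, hb', hby⟩ := hKY y.2
    have hne : a ≠ b := by
      rintro rfl
      exact hxy (Subtype.ext (hax.symm.trans hby))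
    have hd : 0 < ‖a - b‖ := norm_pos_iff.2 (sub_ne_zero.2 hne)
    obtain ⟨_, ⟨k, rfl⟩, hk⟩ := Metric.mem_closure_iff.1 (hD (Y.sub_mem ha hb')) (‖a - b‖ / 4)
      (by linarith)
    refine ⟨k, ?_⟩
    simp only [← hax, ← hby, LinearEquiv.symm_apply_apply]
    intro heq
    have h0 : l k (a - b) = 0 := by rw [map_sub, heq, sub_self]
    rw [dist_eq_norm] at hk
    have h1 : ‖l k (a - b - c k)‖ ≤ ‖a - b - c k‖ :=
      ((l k).le_opNorm _).trans (mul_le_of_le_one_left (norm_nonneg _) (hl1 k))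
    have h2 : l k (c k) = ‖c k‖ := by simpa using hl2 k
    rw [map_sub, h0, h2, zero_sub, norm_neg, norm_norm] at h1
    have h3 : ‖a - b‖ ≤ ‖a - b - c k‖ + ‖c k‖ := by
      simpa using norm_add_le (a - b - c k) (c k)
    linarith
  obtain ⟨x, σ, hσ, hx⟩ := CompactSpace.tendsto_subseq (fun n : ℕ =>
    (⟨toWeakSpace ℝ X (u n), subset_closure ⟨_, ⟨n, rfl⟩, rfl⟩⟩ : closure S))
  refine ⟨(toWeakSpace ℝ X).symm x.1, σ, hσ, fun g => ?_⟩
  have hg : Continuous (fun k : closure S => g ((toWeakSpace ℝ X).symm k.1)) :=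
    (hev g).comp continuous_subtype_val
  exact (hg.tendsto x).comp hx

theorem stmt3 {X : Type*} [NormedAddCommGroup X] [NormedSpace ℝ X] [CompleteSpace X]
    (hrefl : Function.Surjective (NormedSpace.inclusionInDoubleDual ℝ X))
    (φ ψ₁ ψ₂ : X → ℝ) (α : ℝ) (hα : 1 < α)
    (hφC : ContDiff ℝ 1 φ) (hψ₁C : ContDiff ℝ 1 ψ₁) (hψ₂C : ContDiff ℝ 1 ψ₂)
    (hφe : ∀ u, φ (-u) = φ u) (hψ₁e : ∀ u, ψ₁ (-u) = ψ₁ u) (hψ₂e : ∀ u, ψ₂ (-u) = ψ₂ u)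
    (hφh : ∀ t : ℝ, 0 < t → ∀ u, φ (t • u) = t ^ α * φ u)
    (hψ₁h : ∀ t : ℝ, 0 < t → ∀ u, ψ₁ (t • u) = t ^ α * ψ₁ u)
    (hψ₂h : ∀ t : ℝ, 0 < t → ∀ u, ψ₂ (t • u) = t ^ α * ψ₂ u)
    (hS : ∀ lam : ℝ, 0 < lam →
      ClassSPlus (fun u => fderiv ℝ φ u + lam • fderiv ℝ ψ₂ u))
    (hcc : CompletelyContinuous (fun u => fderiv ℝ ψ₁ u))
    (hpos : ∀ u : X, u ≠ 0 → 0 ≤ ψ₁ u - ψ₂ u → 0 < φ u)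
    (hne : {u : X | ψ₁ u - ψ₂ u = 1}.Nonempty) :
    0 < sInf (φ '' {u : X | ψ₁ u - ψ₂ u = 1}) := by
  have z : ∀ f : X → ℝ, (∀ t : ℝ, 0 < t → ∀ u, f (t • u) = t ^ α * f u) → f 0 = 0 := by
    intro f hf
    have h := hf 2 two_pos 0
    rw [smul_zero] at h
    have h2 : (1 : ℝ) < 2 ^ α := Real.one_lt_rpow one_lt_two (by linarith)
    have h3 : ((2 : ℝ) ^ α - 1) * f 0 = 0 := by linarith
    rcases mul_eq_zero.1 h3 with h4 | h4
    · linarith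
    · exact h4
  have zφ := z φ hφh
  have zψ₁ := z ψ₁ hψ₁h
  have zψ₂ := z ψ₂ hψ₂h
  have dφ : ∀ u, HasFDerivAt φ (fderiv ℝ φ u) u :=
    fun u => (hφC.differentiable one_ne_zero u).hasFDerivAt
  have dψ₁ : ∀ u, HasFDerivAt ψ₁ (fderiv ℝ ψ₁ u) u :=
    fun u => (hψ₁C.differentiable one_ne_zero u).hasFDerivAt
  have dψ₂ : ∀ u, HasFDerivAt ψ₂ (fderiv ℝ ψ₂ u) u :=
    fun u => (hψ₂C.differentiable one_ne_zero u).hasFDerivAt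
  by_contra hcon
  rw [not_lt] at hcon
  -- elements of the manifold are bounded away from zero
  obtain ⟨δ, hδ, hδM⟩ : ∃ δ > 0, ∀ u, ψ₁ u - ψ₂ u = 1 → δ ≤ ‖u‖ := by
    have hc : Continuous fun u => ψ₁ u - ψ₂ u := hψ₁C.continuous.sub hψ₂C.continuous
    have h1 : ∀ᶠ u in 𝓝 (0 : X), ψ₁ u - ψ₂ u < 1 :=
      (hc.tendsto 0).eventually (gt_mem_nhds (by rw [zψ₁, zψ₂]; norm_num))
    obtain ⟨δ, hδ, h⟩ := Metric.eventually_nhds_iff.1 h1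
    refine ⟨δ, hδ, fun u hu => ?_⟩
    by_contra hlt
    have := h (y := u) (by rw [dist_zero_right]; exact not_le.1 hlt)
    linarith
  have key : ∀ n : ℕ, ∃ v : X, ‖v‖ = 1 ∧ 0 ≤ ψ₁ v - ψ₂ v ∧ φ v < 1 / ((n : ℝ) + 1) := by
    intro n
    have hε : (0 : ℝ) < 1 / ((n : ℝ) + 1) := by positivity
    have hδα : 0 < δ ^ α := Real.rpow_pos_of_pos hδ α
    obtain ⟨_, ⟨u, hu, rfl⟩, hlt⟩ := exists_lt_of_csInf_lt (hne.image φ)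
      (lt_of_le_of_lt hcon (mul_pos hε hδα))
    have hu' : ψ₁ u - ψ₂ u = 1 := hu
    have hun := hδM u hu'
    have hpn : 0 < ‖u‖ := hδ.trans_le hun
    have hφpos : 0 < φ u := hpos u (norm_pos_iff.1 hpn) (by linarith)
    have hin : 0 < ‖u‖⁻¹ := inv_pos.2 hpn
    have hinα : 0 < ‖u‖⁻¹ ^ α := Real.rpow_pos_of_pos hin α
    refine ⟨‖u‖⁻¹ • u, ?_, ?_, ?_⟩
    · rw [norm_smul, norm_inv, norm_norm, inv_mul_cancel₀ hpn.ne']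
    · rw [hψ₁h _ hin, hψ₂h _ hin, ← mul_sub, hu', mul_one]
      exact hinα.le
    · rw [hφh _ hin, Real.inv_rpow hpn.le, inv_mul_lt_iff₀ (Real.rpow_pos_of_pos hpn α)]
      have : δ ^ α ≤ ‖u‖ ^ α := Real.rpow_le_rpow hδ.le hun (by linarith)
      calc φ u < 1 / ((n : ℝ) + 1) * δ ^ α := hlt
        _ ≤ 1 / ((n : ℝ) + 1) * ‖u‖ ^ α := by gcongr
        _ = _ := mul_comm _ _
  choose w hw1 hw2 hw3 using key
  obtain ⟨v, σ, hσ, hwv⟩ := weak_seq_compact_aux hrefl w (by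
    rw [isBounded_iff_forall_norm_le]
    refine ⟨1, ?_⟩
    rintro _ ⟨n, rfl⟩
    exact (hw1 n).le)
  have hC0 : ∀ n, ‖w n - v‖ ≤ 1 + ‖v‖ := fun n => by
    have := norm_sub_le (w n) v
    rwa [hw1] at this
  obtain ⟨τ, hτ, hψlim⟩ := wcont_aux dψ₁ hcc hwv (1 + ‖v‖) (fun n => hC0 _)
  have hwk : WeakConvSeq (fun n => w (σ (τ n))) v := fun l => (hwv l).comp hτ.tendsto_atTop
  have hφsmall : ∀ ε > 0, ∀ᶠ n in atTop, φ (w (σ (τ n))) < ε := by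
    intro ε hε
    have h1 : Tendsto (fun n : ℕ => 1 / ((n : ℝ) + 1)) atTop (𝓝 0) :=
      tendsto_one_div_add_atTop_nhds_zero_nat
    have h2 := (h1.comp (hσ.comp hτ).tendsto_atTop).eventually (gt_mem_nhds hε)
    filter_upwards [h2] with n hn
    exact (hw3 _).trans hn
  have dsum : ∀ lam : ℝ, ∀ u, HasFDerivAt (fun u => φ u + lam * ψ₂ u)
      (fderiv ℝ φ u + lam • fderiv ℝ ψ₂ u) u := fun lam u =>
    (dφ u).add ((dψ₂ u).const_mul lam)
  have hFc : ∀ lam : ℝ, Continuous fun u => fderiv ℝ φ u + lam • fderiv ℝ ψ₂ u := fun lam =>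
    (hφC.continuous_fderiv one_ne_zero).add
      ((hψ₂C.continuous_fderiv one_ne_zero).const_smul lam)
  have hineq : ∀ lam : ℝ, 0 < lam → φ v ≤ lam * (ψ₁ v - ψ₂ v) := by
    intro lam hlam
    refine le_of_forall_pos_le_add fun ε hε => ?_
    have e1 := wlsc_aux (dsum lam) (hFc lam) (hS lam hlam) hwk (1 + ‖v‖) (fun n => hC0 _)
      (ε / 3) (by linarith)
    have e2 := hφsmall (ε / 3) (by linarith)
    have e3 : ∀ᶠ n in atTop, lam * ψ₁ (w (σ (τ n))) < lam * ψ₁ v + ε / 3 :=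
      (hψlim.const_mul lam).eventually (gt_mem_nhds (by linarith))
    obtain ⟨n, h1, h2, h3⟩ := (e1.and (e2.and e3)).exists
    have h4 := mul_nonneg hlam.le (hw2 (σ (τ n)))
    nlinarith
  have hφv : φ v ≤ 0 := by
    by_contra hp
    rw [not_le] at hp
    have h1 := hineq 1 one_pos
    have hd : 0 < ψ₁ v - ψ₂ v := by linarith
    have h2 := hineq (φ v / (2 * (ψ₁ v - ψ₂ v))) (by positivity)
    have h3 : φ v / (2 * (ψ₁ v - ψ₂ v)) * (ψ₁ v - ψ₂ v) = φ v / 2 := by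
      field_simp
    linarith
  have hψv : 0 ≤ ψ₁ v - ψ₂ v := by
    by_contra hp
    rw [not_le] at hp
    have hd : 0 < -(ψ₁ v - ψ₂ v) := by linarith
    have h2 := hineq ((1 - φ v) / -(ψ₁ v - ψ₂ v)) (div_pos (by linarith) hd)
    have h3 : (1 - φ v) / -(ψ₁ v - ψ₂ v) * -(ψ₁ v - ψ₂ v) = 1 - φ v :=
      div_mul_cancel₀ _ hd.ne'
    linarith
  have hv0 : v = 0 := by
    by_contra hv
    exact absurd (hpos v hv hψv) (not_lt.2 hφv)
  subst hv0
  have hstrong := hS 1 one_pos _ _ hwk (limsup_le_zero_aux_s3 _ fun ε hε => by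
    have hα0 : 0 < α := by linarith
    have hε2 : 0 < ε / (2 * α) := by positivity
    have e3 : ∀ᶠ n in atTop, ψ₁ (w (σ (τ n))) < ε / (2 * α) :=
      hψlim.eventually (gt_mem_nhds (by rw [zψ₁]; exact hε2))
    filter_upwards [hφsmall _ hε2, e3] with n h1 h2
    have he := euler_aux (dsum 1) α (fun t ht u => by
      rw [hφh t ht, hψ₂h t ht]; ring) (w (σ (τ n)))
    rw [sub_zero]
    refine he.le.trans ?_
    have h3 := hw2 (σ (τ n))
    have h4 : φ (w (σ (τ n))) + 1 * ψ₂ (w (σ (τ n))) ≤ 2 * (ε / (2 * α)) := by linarith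
    calc _ ≤ α * (2 * (ε / (2 * α))) := by gcongr
      _ = ε := by field_simp)
  have hn := hstrong.norm
  simp only [hw1, norm_zero] at hn
  exact one_ne_zero (tendsto_nhds_unique tendsto_const_nhds hn)
end
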